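/- (Example 2: involutivity of the non-Benenti-type Hamiltonians.) On the open subset of ℝ⁶ (coordinates (q₁,q₂,q₃,p₁,p₂,p₃)) where σ₂ := (1/4)q₁² + q₂ ≠ 0, define σ₁ := q₁, σ₃ := (1/2)q₁q₂ + q₃, and, with E₁ = p₁p₃ + (1/2)p₂², E₂ = p₁p₂ + (1/2)q₁p₂² + (1/2)q₁p₁p₃ − (1/2)q₂p₂p₃ − (1/2)q₃p₃², E₃ = (1/2)p₁² + (1/8)q₁²p₂² + (1/8)q₂²p₃² + (1/2)q₁p₁p₂ + (1/2)q₂p₁p₃ − ((1/4)q₁q₂ + q₃)p₂p₃, set h₁^{(1)} := −E₂/σ₂, h₂^{(1)} := E₁ − (σ₁/σ₂)E₂, h₁^{(2)} := E₃ − (σ₃/σ₂)E₂. Then {h₁^{(1)}, h₂^{(1)}} = 0, {h₁^{(1)}, h₁^{(2)}} = 0, and {h₂^{(1)}, h₁^{(2)}} = 0 at every point of this open set, where {·,·} is the canonical Poisson bracket. -/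

import Mathlib

noncomputable section Stmt15

/-- Partial derivative in the `i`-th coordinate direction on `ℝ⁶`. -/
def pd (i : Fin 6) (F : (Fin 6 → ℝ) → ℝ) (x : Fin 6 → ℝ) : ℝ :=
  fderiv ℝ F x (Pi.single i 1)

/-- The canonical Poisson bracket on `ℝ⁶` with coordinates
`(q₁,q₂,q₃,p₁,p₂,p₃) = (x 0, x 1, x 2, x 3, x 4, x 5)`. -/
def pb (F G : (Fin 6 → ℝ) → ℝ) (x : Fin 6 → ℝ) : ℝ :=
  (pd 0 F x * pd 3 G x - pd 3 F x * pd 0 G x) +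
  (pd 1 F x * pd 4 G x - pd 4 F x * pd 1 G x) +
  (pd 2 F x * pd 5 G x - pd 5 F x * pd 2 G x)

def E1 (x : Fin 6 → ℝ) : ℝ := x 3 * x 5 + (1/2) * x 4 ^ 2

def E2 (x : Fin 6 → ℝ) : ℝ :=
  x 3 * x 4 + (1/2) * x 0 * x 4 ^ 2 + (1/2) * x 0 * x 3 * x 5
    - (1/2) * x 1 * x 4 * x 5 - (1/2) * x 2 * x 5 ^ 2

def E3 (x : Fin 6 → ℝ) : ℝ :=
  (1/2) * x 3 ^ 2 + (1/8) * x 0 ^ 2 * x 4 ^ 2 + (1/8) * x 1 ^ 2 * x 5 ^ 2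
    + (1/2) * x 0 * x 3 * x 4 + (1/2) * x 1 * x 3 * x 5
    - ((1/4) * x 0 * x 1 + x 2) * x 4 * x 5

def sigma1 (x : Fin 6 → ℝ) : ℝ := x 0
def sigma2 (x : Fin 6 → ℝ) : ℝ := (1/4) * x 0 ^ 2 + x 1
def sigma3 (x : Fin 6 → ℝ) : ℝ := (1/2) * x 0 * x 1 + x 2

def h11 (x : Fin 6 → ℝ) : ℝ := -(E2 x) / sigma2 x
def h21 (x : Fin 6 → ℝ) : ℝ := E1 x - (sigma1 x / sigma2 x) * E2 x
def h12 (x : Fin 6 → ℝ) : ℝ := E3 x - (sigma3 x / sigma2 x) * E2 x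


lemma dE1 (x : Fin 6 → ℝ) : DifferentiableAt ℝ E1 x := by unfold E1; fun_prop
lemma dE2 (x : Fin 6 → ℝ) : DifferentiableAt ℝ E2 x := by unfold E2; fun_prop
lemma dE3 (x : Fin 6 → ℝ) : DifferentiableAt ℝ E3 x := by unfold E3; fun_prop
lemma ds1 (x : Fin 6 → ℝ) : DifferentiableAt ℝ sigma1 x := by unfold sigma1; fun_prop
lemma ds2 (x : Fin 6 → ℝ) : DifferentiableAt ℝ sigma2 x := by unfold sigma2; fun_prop
lemma ds3 (x : Fin 6 → ℝ) : DifferentiableAt ℝ sigma3 x := by unfold sigma3; fun_prop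

lemma pd_proj (i j : Fin 6) (x : Fin 6 → ℝ) :
    fderiv ℝ (fun y : Fin 6 → ℝ => y j) x (Pi.single i 1) = if j = i then 1 else 0 := by
  have : HasFDerivAt (fun y : Fin 6 → ℝ => y j)
    (ContinuousLinearMap.proj (R := ℝ) (φ := fun _ : Fin 6 => ℝ) j) x :=
    (ContinuousLinearMap.proj (R := ℝ) (φ := fun _ : Fin 6 => ℝ) j).hasFDerivAt
  rw [this.fderiv]
  simp [Pi.single_apply]

lemma pd_add {F G : (Fin 6 → ℝ) → ℝ} {x : Fin 6 → ℝ} (i : Fin 6)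
    (hF : DifferentiableAt ℝ F x) (hG : DifferentiableAt ℝ G x) :
    pd i (fun y => F y + G y) x = pd i F x + pd i G x := by
  simp [pd, fderiv_fun_add hF hG]

lemma pd_sub {F G : (Fin 6 → ℝ) → ℝ} {x : Fin 6 → ℝ} (i : Fin 6)
    (hF : DifferentiableAt ℝ F x) (hG : DifferentiableAt ℝ G x) :
    pd i (fun y => F y - G y) x = pd i F x - pd i G x := by
  simp [pd, fderiv_fun_sub hF hG]

lemma pd_neg {F : (Fin 6 → ℝ) → ℝ} {x : Fin 6 → ℝ} (i : Fin 6) :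
    pd i (fun y => - F y) x = - pd i F x := by
  simp [pd, fderiv_fun_neg]

lemma pd_mul {F G : (Fin 6 → ℝ) → ℝ} {x : Fin 6 → ℝ} (i : Fin 6)
    (hF : DifferentiableAt ℝ F x) (hG : DifferentiableAt ℝ G x) :
    pd i (fun y => F y * G y) x = F x * pd i G x + G x * pd i F x := by
  simp [pd, fderiv_fun_mul hF hG]

lemma pd_sq {F : (Fin 6 → ℝ) → ℝ} {x : Fin 6 → ℝ} (i : Fin 6)
    (hF : DifferentiableAt ℝ F x) :
    pd i (fun y => F y ^ 2) x = 2 * F x * pd i F x := by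
  simp only [pow_two]; rw [pd_mul i hF hF]; ring

lemma pd_const (c : ℝ) {x : Fin 6 → ℝ} (i : Fin 6) :
    pd i (fun _ => c) x = 0 := by
  simp [pd]

lemma dif_div {F G : (Fin 6 → ℝ) → ℝ} {x : Fin 6 → ℝ}
    (hF : DifferentiableAt ℝ F x) (hG : DifferentiableAt ℝ G x) (h0 : G x ≠ 0) :
    DifferentiableAt ℝ (fun y => F y / G y) x := by
  simp only [div_eq_mul_inv]
  exact hF.fun_mul (hG.fun_inv h0)

lemma pd_div {F G : (Fin 6 → ℝ) → ℝ} {x : Fin 6 → ℝ} (i : Fin 6)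
    (hF : DifferentiableAt ℝ F x) (hG : DifferentiableAt ℝ G x) (h0 : G x ≠ 0) :
    pd i (fun y => F y / G y) x = (pd i F x - F x / G x * pd i G x) / G x := by
  have hQ : DifferentiableAt ℝ (fun y => F y / G y) x := dif_div hF hG h0
  have h1 := pd_mul i hQ hG
  have h2 : pd i (fun y => F y / G y * G y) x = pd i F x := by
    unfold pd
    congr 1
    apply Filter.EventuallyEq.fderiv_eq
    filter_upwards [hG.continuousAt.eventually_ne h0] with y hy
    field_simp
  rw [h2] at h1
  rw [h1]
  field_simp
  ring

lemma pd_coord (i j : Fin 6) (x : Fin 6 → ℝ) :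
    pd i (fun y : Fin 6 → ℝ => y j) x = if j = i then 1 else 0 := pd_proj i j x

lemma pd_h11 (i : Fin 6) (x : Fin 6 → ℝ) (h : sigma2 x ≠ 0) :
    pd i h11 x = (-pd i E2 x + E2 x / sigma2 x * pd i sigma2 x) / sigma2 x := by
  unfold h11
  rw [pd_div i (dE2 x).fun_neg (ds2 x) h, pd_neg]; ring

lemma pd_h21 (i : Fin 6) (x : Fin 6 → ℝ) (h : sigma2 x ≠ 0) :
    pd i h21 x = pd i E1 x - (sigma1 x / sigma2 x * pd i E2 x +
      E2 x * ((pd i sigma1 x - sigma1 x / sigma2 x * pd i sigma2 x) / sigma2 x)) := by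
  unfold h21
  have hd := dif_div (ds1 x) (ds2 x) h
  rw [pd_sub i (dE1 x) (hd.fun_mul (dE2 x)), pd_mul i hd (dE2 x), pd_div i (ds1 x) (ds2 x) h]

lemma pd_h12 (i : Fin 6) (x : Fin 6 → ℝ) (h : sigma2 x ≠ 0) :
    pd i h12 x = pd i E3 x - (sigma3 x / sigma2 x * pd i E2 x +
      E2 x * ((pd i sigma3 x - sigma3 x / sigma2 x * pd i sigma2 x) / sigma2 x)) := by
  unfold h12
  have hd := dif_div (ds3 x) (ds2 x) h
  rw [pd_sub i (dE3 x) (hd.fun_mul (dE2 x)), pd_mul i hd (dE2 x), pd_div i (ds3 x) (ds2 x) h]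

lemma pd_E1 (i : Fin 6) (x : Fin 6 → ℝ) : pd i E1 x =
    (![0,
      0,
      0,
      x 5,
      x 4,
      x 3] : Fin 6 → ℝ) i := by
  unfold E1
  simp (disch := fun_prop) only [pd_add, pd_sub, pd_mul, pd_sq, pd_const, pd_coord]
  fin_cases i <;> simp <;> ring

lemma pd_E2 (i : Fin 6) (x : Fin 6 → ℝ) : pd i E2 x =
    (![(1/2) * x 4 ^ 2 + (1/2) * x 3 * x 5,
      -(1/2) * x 4 * x 5,
      -(1/2) * x 5 ^ 2,
      x 4 + (1/2) * x 0 * x 5,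
      x 3 + x 0 * x 4 - (1/2) * x 1 * x 5,
      (1/2) * x 0 * x 3 - (1/2) * x 1 * x 4 - x 2 * x 5] : Fin 6 → ℝ) i := by
  unfold E2
  simp (disch := fun_prop) only [pd_add, pd_sub, pd_mul, pd_sq, pd_const, pd_coord]
  fin_cases i <;> simp <;> ring

lemma pd_E3 (i : Fin 6) (x : Fin 6 → ℝ) : pd i E3 x =
    (![(1/4) * x 0 * x 4 ^ 2 + (1/2) * x 3 * x 4 - (1/4) * x 1 * x 4 * x 5,
      (1/4) * x 1 * x 5 ^ 2 + (1/2) * x 3 * x 5 - (1/4) * x 0 * x 4 * x 5,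
      - x 4 * x 5,
      x 3 + (1/2) * x 0 * x 4 + (1/2) * x 1 * x 5,
      (1/4) * x 0 ^ 2 * x 4 + (1/2) * x 0 * x 3 - ((1/4) * x 0 * x 1 + x 2) * x 5,
      (1/4) * x 1 ^ 2 * x 5 + (1/2) * x 1 * x 3 - ((1/4) * x 0 * x 1 + x 2) * x 4] : Fin 6 → ℝ) i := by
  unfold E3
  simp (disch := fun_prop) only [pd_add, pd_sub, pd_mul, pd_sq, pd_const, pd_coord]
  fin_cases i <;> simp <;> ring

lemma pd_sigma1 (i : Fin 6) (x : Fin 6 → ℝ) : pd i sigma1 x =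
    (![1,
      0,
      0,
      0,
      0,
      0] : Fin 6 → ℝ) i := by
  unfold sigma1
  simp (disch := fun_prop) only [pd_add, pd_sub, pd_mul, pd_sq, pd_const, pd_coord]
  fin_cases i <;> simp <;> ring

lemma pd_sigma2 (i : Fin 6) (x : Fin 6 → ℝ) : pd i sigma2 x =
    (![(1/2) * x 0,
      1,
      0,
      0,
      0,
      0] : Fin 6 → ℝ) i := by
  unfold sigma2
  simp (disch := fun_prop) only [pd_add, pd_sub, pd_mul, pd_sq, pd_const, pd_coord]
  fin_cases i <;> simp <;> ring

lemma pd_sigma3 (i : Fin 6) (x : Fin 6 → ℝ) : pd i sigma3 x =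
    (![(1/2) * x 1,
      (1/2) * x 0,
      1,
      0,
      0,
      0] : Fin 6 → ℝ) i := by
  unfold sigma3
  simp (disch := fun_prop) only [pd_add, pd_sub, pd_mul, pd_sq, pd_const, pd_coord]
  fin_cases i <;> simp <;> ring

/-- Example 2: involutivity of the non-Benenti-type Hamiltonians on the open
set where `σ₂ ≠ 0`. -/
theorem stmt15 : ∀ x : Fin 6 → ℝ, sigma2 x ≠ 0 →
    pb h11 h21 x = 0 ∧ pb h11 h12 x = 0 ∧ pb h21 h12 x = 0 := by
  intro x hx
  have h1 : x 1 = sigma2 x - (1/4) * x 0 ^ 2 := by unfold sigma2; ring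
  simp only [pb, pd_h11 _ x hx, pd_h21 _ x hx, pd_h12 _ x hx, pd_E1, pd_E2, pd_E3,
    pd_sigma1, pd_sigma2, pd_sigma3]
  have e1 : sigma1 x = x 0 := rfl
  have e3 : sigma3 x = (1/2) * x 0 * x 1 + x 2 := rfl
  rw [e1, e3]
  generalize sigma2 x = s at *
  simp only [E2, h1]
  refine ⟨?_, ?_, ?_⟩
  all_goals
    simp
    field_simp
    ring

end Stmt15
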